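/- Let n ≥ 1, z₀ = (x₀, t₀) with x₀ ∈ ℝⁿ and t₀ > 0. Let ρ : ℝⁿ × (0, t₀) → ℝ be smooth and nonnegative and e : ℝⁿ × (0, t₀) → ℝ be continuous and nonnegative, and assume the pointwise inequality ∂_t ρ − Δρ ≤ −2e on ℝⁿ × (0, t₀). Assume moreover that for every τ ∈ (0, t₀) the functions ρ, |∇ρ|, |Δρ|, |∂_t ρ| are bounded on ℝⁿ × (τ, t₀). Define, for 0 < R < √t₀, H(R) = ∫_{ℝⁿ} ρ(x, t₀ − R²) G_{z₀}(x, t₀ − R²) dx and E(R) = 2R² ∫_{ℝⁿ} e(x, t₀ − R²) G_{z₀}(x, t₀ − R²) dx. Then H is differentiable on (0, √t₀) and E(R) ≤ (R/2) H′(R) for every R ∈ (0, √t₀); in particular H is nondecreasing. -/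

import Mathlib

open Set MeasureTheory

/-- Time derivative `∂ₜ ρ (x,t)`. -/
noncomputable def pt {n : ℕ} {E : Type*} [NormedAddCommGroup E] [NormedSpace ℝ E]
    (u : EuclideanSpace ℝ (Fin n) → ℝ → E) (x : EuclideanSpace ℝ (Fin n)) (t : ℝ) : E :=
  deriv (fun s => u x s) t

/-- Spatial partial derivative `∂_{xⱼ} ρ (x,t)`. -/
noncomputable def px {n : ℕ} {E : Type*} [NormedAddCommGroup E] [NormedSpace ℝ E]
    (u : EuclideanSpace ℝ (Fin n) → ℝ → E) (j : Fin n)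
    (x : EuclideanSpace ℝ (Fin n)) (t : ℝ) : E :=
  fderiv ℝ (fun y => u y t) x (EuclideanSpace.single j 1)

/-- Spatial Laplacian `Δρ (x,t) = Σⱼ ∂²ρ/∂xⱼ²`. -/
noncomputable def lapv {n : ℕ} {E : Type*} [NormedAddCommGroup E] [NormedSpace ℝ E]
    (u : EuclideanSpace ℝ (Fin n) → ℝ → E) (x : EuclideanSpace ℝ (Fin n)) (t : ℝ) : E :=
  ∑ j, px (fun y s => px u j y s) j x t

/-- The backward heat kernel centered at `z₀ = (x₀,t₀)`:
`G_{z₀}(x,t) = (4π(t₀−t))^{−n/2} exp(−|x−x₀|²/(4(t₀−t)))` for `t < t₀`. -/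
noncomputable def bkHeatKernel {n : ℕ} (x₀ : EuclideanSpace ℝ (Fin n)) (t₀ : ℝ)
    (x : EuclideanSpace ℝ (Fin n)) (t : ℝ) : ℝ :=
  (4 * Real.pi * (t₀ - t)) ^ (-(n : ℝ) / 2) * Real.exp (-‖x - x₀‖ ^ 2 / (4 * (t₀ - t)))

open Filter Topology

lemma gauss_int (n : ℕ) {b : ℝ} (hb : 0 < b) :
    Integrable (fun y : EuclideanSpace ℝ (Fin n) => Real.exp (-b * ‖y‖ ^ 2)) := by
  have h := (GaussianFourier.integrable_cexp_neg_mul_sq_norm_add_of_euclideanSpace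
    (ι := Fin n) (b := (b : ℂ)) (by simpa using hb) 0 0).norm
  refine h.congr (Eventually.of_forall fun y => ?_)
  simp only [Complex.norm_exp]
  congr 1
  simp [← Complex.ofReal_pow]

noncomputable def gw {n : ℕ} (y : EuclideanSpace ℝ (Fin n)) : ℝ := Real.exp (-(1/4) * ‖y‖ ^ 2)

lemma gw_pos {n : ℕ} (y : EuclideanSpace ℝ (Fin n)) : 0 < gw y := Real.exp_pos _

lemma gw_int (n : ℕ) : Integrable (fun y : EuclideanSpace ℝ (Fin n) => gw y) :=
  gauss_int n (by norm_num)

lemma gw_contDiff (n : ℕ) : ContDiff ℝ 1 (fun y : EuclideanSpace ℝ (Fin n) => gw y) := by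
  unfold gw
  exact Real.contDiff_exp.comp (contDiff_const.mul (contDiff_norm_sq ℝ))

lemma gw_norm_int (n : ℕ) : Integrable (fun y : EuclideanSpace ℝ (Fin n) => ‖y‖ * gw y) := by
  refine Integrable.mono' ((gauss_int n (b := 1/8) (by norm_num)).const_mul 2) ?_ ?_
  · exact (continuous_norm.mul (gw_contDiff n).continuous).aestronglyMeasurable
  · refine Eventually.of_forall fun y => ?_
    have h1 := gw_pos y
    rw [Real.norm_of_nonneg (by positivity)]
    have h2 : Real.exp (-(1/8) * ‖y‖ ^ 2) = Real.exp ((1/8) * ‖y‖ ^ 2) * gw y := by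
      rw [gw, ← Real.exp_add]; congr 1; ring
    rw [h2, ← mul_assoc]
    gcongr
    have := Real.add_one_le_exp ((1/8) * ‖y‖ ^ 2)
    nlinarith [sq_nonneg (‖y‖ - 2)]

lemma gw_fderiv {n : ℕ} (y v : EuclideanSpace ℝ (Fin n)) :
    fderiv ℝ (fun y => gw y) y v = -(1/2) * inner ℝ y v * gw y := by
  have h : HasFDerivAt (fun y : EuclideanSpace ℝ (Fin n) => gw y) _ y :=
    ((((hasStrictFDerivAt_norm_sq y).hasFDerivAt).const_mul (-(1/4) : ℝ))).exp
  rw [h.fderiv]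
  simp [gw]
  ring

lemma ibp_compact {n : ℕ} (w : EuclideanSpace ℝ (Fin n) → ℝ) (hw : ContDiff ℝ 1 w)
    (hc : HasCompactSupport w) (u : Fin n → EuclideanSpace ℝ (Fin n) → ℝ)
    (hu : ∀ j, ContDiff ℝ 1 (u j)) :
    ∫ y, w y * ∑ j, fderiv ℝ (u j) y (EuclideanSpace.single j 1)
      = - ∫ y, ∑ j, fderiv ℝ w y (EuclideanSpace.single j 1) * u j y := by
  have c1 : ∀ v, Continuous fun y => fderiv ℝ w y v := fun v =>
    (hw.continuous_fderiv one_ne_zero).clm_apply continuous_const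
  have c2 : ∀ j v, Continuous fun y => fderiv ℝ (u j) y v := fun j v =>
    ((hu j).continuous_fderiv one_ne_zero).clm_apply continuous_const
  have hc' : ∀ v, HasCompactSupport fun y => fderiv ℝ w y v := fun v => hc.fderiv_apply ℝ v
  have i1 : ∀ j v, Integrable fun y => w y * fderiv ℝ (u j) y v := fun j v =>
    (hw.continuous.mul (c2 j v)).integrable_of_hasCompactSupport hc.mul_right
  have i2 : ∀ j v, Integrable fun y => fderiv ℝ w y v * u j y := fun j v =>
    ((c1 v).mul (hu j).continuous).integrable_of_hasCompactSupport (hc' v).mul_right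
  have i3 : ∀ j, Integrable fun y => w y * u j y := fun j =>
    (hw.continuous.mul (hu j).continuous).integrable_of_hasCompactSupport hc.mul_right
  simp_rw [Finset.mul_sum]
  rw [integral_finsetSum _ (fun j _ => i1 j _), integral_finsetSum _ (fun j _ => i2 j _),
    ← Finset.sum_neg_distrib]
  refine Finset.sum_congr rfl fun j _ => ?_
  exact integral_mul_fderiv_eq_neg_fderiv_mul_of_integrable (i2 j _) (i1 j _) (i3 j)
    (fun x _ => hw.differentiable one_ne_zero x) (fun x _ => (hu j).differentiable one_ne_zero x)

lemma ibp_gauss {n : ℕ} (u : Fin n → EuclideanSpace ℝ (Fin n) → ℝ)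
    (hu : ∀ j, ContDiff ℝ 1 (u j)) (C : ℝ) (hC : ∀ j y, |u j y| ≤ C)
    (hS : ∀ y, |∑ j, fderiv ℝ (u j) y (EuclideanSpace.single j 1)| ≤ C) :
    ∫ y, (∑ j, fderiv ℝ (u j) y (EuclideanSpace.single j 1)) * gw y
      = (1/2) * ∫ y, (∑ j, y j * u j y) * gw y := by
  have hC0 : 0 ≤ C := (abs_nonneg _).trans (hS 0)
  let χ : ContDiffBump (0 : EuclideanSpace ℝ (Fin n)) := ⟨1, 2, one_pos, one_lt_two⟩
  have hχ : ContDiff ℝ 1 (χ : EuclideanSpace ℝ (Fin n) → ℝ) := χ.contDiff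
  have hχf : Continuous (fderiv ℝ (χ : EuclideanSpace ℝ (Fin n) → ℝ)) :=
    hχ.continuous_fderiv one_ne_zero
  obtain ⟨D, hD⟩ := (χ.hasCompactSupport.fderiv ℝ).exists_bound_of_continuous hχf
  have hD0 : 0 ≤ D := (norm_nonneg _).trans (hD 0)
  let a : ℕ → ℝ := fun k => 1 / ((k : ℝ) + 1)
  have ha0 : ∀ k, 0 < a k := fun k => by positivity
  have ha1 : ∀ k, a k ≤ 1 := fun k => by
    simp only [a]; rw [div_le_one (by positivity)]; linarith [(Nat.cast_nonneg k : (0:ℝ) ≤ k)]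
  have ha : Tendsto a atTop (𝓝 0) := tendsto_one_div_add_atTop_nhds_zero_nat
  have hay : ∀ y : EuclideanSpace ℝ (Fin n), Tendsto (fun k => a k • y) atTop (𝓝 0) := fun y => by
    simpa using ha.smul_const y
  have hχ1 : ∀ y : EuclideanSpace ℝ (Fin n), Tendsto (fun k => χ (a k • y)) atTop (𝓝 1) := fun y => by
    have h0 : χ (0 : EuclideanSpace ℝ (Fin n)) = 1 := χ.eventuallyEq_one.eq_of_nhds
    rw [← h0]
    exact (χ.continuous.tendsto 0).comp (hay y)
  let w : ℕ → EuclideanSpace ℝ (Fin n) → ℝ := fun k y => χ (a k • y) * gw y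
  have hχk : ∀ k, ContDiff ℝ 1 (fun y : EuclideanSpace ℝ (Fin n) => χ (a k • y)) := fun k =>
    hχ.comp (contDiff_const_smul _)
  have hw : ∀ k, ContDiff ℝ 1 (w k) := fun k => (hχk k).mul (gw_contDiff n)
  have hwc : ∀ k, HasCompactSupport (w k) := fun k => by
    have : HasCompactSupport (fun y : EuclideanSpace ℝ (Fin n) => χ (a k • y)) :=
      χ.hasCompactSupport.comp_smul (ha0 k).ne'
    exact this.mul_right
  have hwd : ∀ k y v, fderiv ℝ (w k) y v = χ (a k • y) * (-(1/2) * inner ℝ y v * gw y)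
      + a k * fderiv ℝ χ (a k • y) v * gw y := by
    intro k y v
    have h1 : HasFDerivAt (fun y : EuclideanSpace ℝ (Fin n) => χ (a k • y))
        ((fderiv ℝ χ (a k • y)).comp (a k • ContinuousLinearMap.id ℝ _)) y :=
      ((hχ.differentiable one_ne_zero (a k • y)).hasFDerivAt).comp y
        ((hasFDerivAt_id y).const_smul (a k))
    have h2 := ((gw_contDiff n).differentiable one_ne_zero y).hasFDerivAt
    have h3 : HasFDerivAt (w k) _ y := h1.mul h2
    rw [h3.fderiv]
    simp only [_root_.add_apply, _root_.smul_apply, gw_fderiv,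
      ContinuousLinearMap.comp_apply, ContinuousLinearMap.id_apply, smul_eq_mul, map_smul]
    ring
  have key : ∀ k, _ := fun k => ibp_compact (w k) (hw k) (hwc k) u hu
  have cS : Continuous fun y => ∑ j, fderiv ℝ (u j) y (EuclideanSpace.single j 1) :=
    continuous_finsetSum _ fun j _ =>
      ((hu j).continuous_fderiv one_ne_zero).clm_apply continuous_const
  have L : Tendsto (fun k => ∫ y, w k y * ∑ j, fderiv ℝ (u j) y (EuclideanSpace.single j 1)) atTop
      (𝓝 (∫ y, (∑ j, fderiv ℝ (u j) y (EuclideanSpace.single j 1)) * gw y)) := by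
    refine tendsto_integral_of_dominated_convergence (fun y => C * gw y) ?_
      ((gw_int n).const_mul C) ?_ ?_
    · exact fun k => ((hw k).continuous.mul cS).aestronglyMeasurable
    · refine fun k => Eventually.of_forall fun y => ?_
      have := gw_pos y
      rw [norm_mul, mul_comm]
      simp only [w, norm_mul, Real.norm_eq_abs, abs_of_pos this, abs_of_nonneg χ.nonneg]
      refine mul_le_mul (hS y) ?_ (mul_nonneg χ.nonneg this.le) hC0
      exact mul_le_of_le_one_left this.le χ.le_one
    · refine Eventually.of_forall fun y => ?_
      have := ((hχ1 y).mul_const (gw y)).mul_const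
        (∑ j, fderiv ℝ (u j) y (EuclideanSpace.single j 1))
      rwa [one_mul, mul_comm] at this
  have Rr : Tendsto (fun k => ∫ y, ∑ j, fderiv ℝ (w k) y (EuclideanSpace.single j 1) * u j y) atTop
      (𝓝 (∫ y, ∑ j, (-(1/2) * y j * gw y) * u j y)) := by
    refine tendsto_integral_of_dominated_convergence
      (fun y => ∑ j : Fin n, (C * (‖y‖ * gw y) + D * C * gw y)) ?_ ?_ ?_ ?_
    · exact fun k => (continuous_finsetSum _ fun j _ =>
        (((hw k).continuous_fderiv one_ne_zero).clm_apply continuous_const).mul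
          (hu j).continuous).aestronglyMeasurable
    · exact integrable_finsetSum _ fun j _ =>
        ((gw_norm_int n).const_mul C).add ((gw_int n).const_mul _)
    · refine fun k => Eventually.of_forall fun y => ?_
      refine (norm_sum_le _ _).trans (Finset.sum_le_sum fun j _ => ?_)
      have hg := gw_pos y
      have hn : ‖(EuclideanSpace.single j (1:ℝ) : EuclideanSpace ℝ (Fin n))‖ = 1 := by simp
      have e1 : |inner ℝ y (EuclideanSpace.single j (1:ℝ))| ≤ ‖y‖ := by
        simpa [hn] using abs_real_inner_le_norm y (EuclideanSpace.single j (1:ℝ))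
      have e2 : |fderiv ℝ χ (a k • y) (EuclideanSpace.single j 1)| ≤ D := by
        have := (fderiv ℝ χ (a k • y)).le_opNorm (EuclideanSpace.single j 1)
        rw [hn, mul_one] at this
        exact this.trans (hD _)
      have e3 : |fderiv ℝ (w k) y (EuclideanSpace.single j 1)| ≤ ‖y‖ * gw y + D * gw y := by
        rw [hwd]
        refine (abs_add_le _ _).trans (add_le_add ?_ ?_)
        · rw [abs_mul, abs_mul, abs_mul, abs_of_nonneg χ.nonneg, abs_of_pos hg]
          have : |(-(1/2) : ℝ)| = 1/2 := by norm_num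
          rw [this]
          refine (mul_le_of_le_one_left (by positivity) χ.le_one).trans ?_
          gcongr
          linarith [abs_nonneg (inner ℝ y (EuclideanSpace.single j (1:ℝ)))]
        · rw [abs_mul, abs_mul, abs_of_pos (ha0 k), abs_of_pos hg]
          gcongr
          exact (mul_le_of_le_one_left (abs_nonneg _) (ha1 k)).trans e2
      rw [norm_mul, Real.norm_eq_abs, Real.norm_eq_abs]
      refine (mul_le_mul e3 (hC j y) (abs_nonneg _) (by positivity)).trans (le_of_eq (by ring))
    · refine Eventually.of_forall fun y => ?_
      refine tendsto_finsetSum _ fun j _ => ?_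
      refine Tendsto.mul_const _ ?_
      simp only [hwd]
      have t1 := (hχ1 y).mul_const (-(1/2) * inner ℝ y (EuclideanSpace.single j (1:ℝ)) * gw y)
      have t2 : Tendsto (fun k => fderiv ℝ χ (a k • y) (EuclideanSpace.single j (1:ℝ))) atTop
          (𝓝 (fderiv ℝ χ 0 (EuclideanSpace.single j (1:ℝ)))) :=
        ((hχf.clm_apply continuous_const).tendsto 0).comp (hay y)
      have t3 := t1.add ((ha.mul t2).mul_const (gw y))
      convert t3 using 2
      simp [EuclideanSpace.inner_single_right]
  have := tendsto_nhds_unique L ((Rr.neg).congr fun k => (key k).symm)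
  rw [this, ← integral_neg, ← integral_const_mul]
  congr 1; ext y
  rw [Finset.sum_mul, Finset.mul_sum, ← Finset.sum_neg_distrib]
  refine Finset.sum_congr rfl fun j _ => by ring

lemma scale_int {n : ℕ} (x₀ : EuclideanSpace ℝ (Fin n)) (t₀ R : ℝ) (hR : 0 < R)
    (f : EuclideanSpace ℝ (Fin n) → ℝ) :
    ∫ x, f x * bkHeatKernel x₀ t₀ x (t₀ - R ^ 2)
      = (4 * Real.pi) ^ (-(n : ℝ) / 2) * ∫ y, f (x₀ + R • y) * gw y := by
  rw [← integral_add_left_eq_self _ x₀]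
  have h := Measure.integral_comp_smul_of_nonneg
    (volume : Measure (EuclideanSpace ℝ (Fin n)))
    (fun x => f (x₀ + x) * bkHeatKernel x₀ t₀ (x₀ + x) (t₀ - R ^ 2)) R (hR := hR.le)
  have hRn : (0:ℝ) < R ^ n := by positivity
  have h2 : ∫ x, f (x₀ + x) * bkHeatKernel x₀ t₀ (x₀ + x) (t₀ - R ^ 2) =
      R ^ n * ∫ x, f (x₀ + R • x) * bkHeatKernel x₀ t₀ (x₀ + R • x) (t₀ - R ^ 2) := by
    rw [h]; simp only [finrank_euclideanSpace, Fintype.card_fin, smul_eq_mul]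
    rw [mul_inv_cancel_left₀ hRn.ne']
  rw [h2, ← integral_const_mul, ← integral_const_mul]
  congr 1; ext y
  have hk : bkHeatKernel x₀ t₀ (x₀ + R • y) (t₀ - R ^ 2)
      = (4 * Real.pi) ^ (-(n : ℝ) / 2) * (R ^ n)⁻¹ * gw y := by
    unfold bkHeatKernel gw
    have e1 : t₀ - (t₀ - R ^ 2) = R ^ 2 := by ring
    rw [e1, Real.mul_rpow (by positivity) (by positivity), add_sub_cancel_left, norm_smul,
      Real.norm_of_nonneg hR.le]
    congr 2
    · rw [← Real.rpow_natCast R 2, ← Real.rpow_mul hR.le, ← Real.rpow_natCast R n,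
        ← Real.rpow_neg hR.le]
      congr 1; push_cast; ring
    · field_simp
  rw [hk]
  field_simp

lemma sum_single {n : ℕ} (A : EuclideanSpace ℝ (Fin n) →L[ℝ] ℝ) (y : EuclideanSpace ℝ (Fin n)) :
    ∑ j, y j * A (EuclideanSpace.single j 1) = A y := by
  conv_rhs => rw [← (EuclideanSpace.basisFun (Fin n) ℝ).sum_repr y]
  simp

lemma main_deriv (n : ℕ) (x₀ : EuclideanSpace ℝ (Fin n)) (t₀ : ℝ)
    (ρ : EuclideanSpace ℝ (Fin n) → ℝ → ℝ)
    (hρsmooth : ContDiffOn ℝ (⊤ : ℕ∞)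
      (fun p : EuclideanSpace ℝ (Fin n) × ℝ => ρ p.1 p.2) (univ ×ˢ Ioo (0 : ℝ) t₀))
    (hρnonneg : ∀ x : EuclideanSpace ℝ (Fin n), ∀ t ∈ Ioo (0 : ℝ) t₀, 0 ≤ ρ x t)
    (hbdd : ∀ τ ∈ Ioo (0 : ℝ) t₀, ∃ Cb : ℝ,
      ∀ x : EuclideanSpace ℝ (Fin n), ∀ t ∈ Ioo τ t₀,
        ρ x t ≤ Cb ∧ ‖fderiv ℝ (fun y => ρ y t) x‖ ≤ Cb ∧
          |lapv ρ x t| ≤ Cb ∧ |pt ρ x t| ≤ Cb)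
    (R : ℝ) (hR : R ∈ Ioo 0 (Real.sqrt t₀)) :
    Integrable (fun y => (2 * R * (lapv ρ (x₀ + R • y) (t₀ - R ^ 2)
        - pt ρ (x₀ + R • y) (t₀ - R ^ 2))) * gw y) ∧
    HasDerivAt (fun r => ∫ y, ρ (x₀ + r • y) (t₀ - r ^ 2) * gw y)
      (∫ y, (2 * R * (lapv ρ (x₀ + R • y) (t₀ - R ^ 2)
        - pt ρ (x₀ + R • y) (t₀ - R ^ 2))) * gw y) R := by
  set P : EuclideanSpace ℝ (Fin n) × ℝ → ℝ := fun p => ρ p.1 p.2 with hPdef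
  have hopen : IsOpen ((univ : Set (EuclideanSpace ℝ (Fin n))) ×ˢ Ioo (0 : ℝ) t₀) :=
    isOpen_univ.prod isOpen_Ioo
  have hP : ∀ x, ∀ t ∈ Ioo (0:ℝ) t₀, ContDiffAt ℝ (⊤ : ℕ∞) P (x, t) := fun x t ht =>
    hρsmooth.contDiffAt (hopen.mem_nhds ⟨mem_univ _, ht⟩)
  have hPd : ∀ x, ∀ t ∈ Ioo (0:ℝ) t₀, HasFDerivAt P (fderiv ℝ P (x, t)) (x, t) := fun x t ht =>
    ((hP x t ht).differentiableAt (by simp)).hasFDerivAt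
  have hslice : ∀ t ∈ Ioo (0:ℝ) t₀, ContDiff ℝ (⊤ : ℕ∞) (fun y => ρ y t) := fun t ht =>
    contDiff_iff_contDiffAt.2 fun x =>
      (hP x t ht).comp x (contDiffAt_id.prodMk contDiffAt_const)
  have hfx : ∀ x, ∀ t ∈ Ioo (0:ℝ) t₀, ∀ v,
      fderiv ℝ (fun y => ρ y t) x v = fderiv ℝ P (x, t) (v, 0) := by
    intro x t ht v
    have h1 : HasFDerivAt (fun y : EuclideanSpace ℝ (Fin n) => (y, t))
        ((ContinuousLinearMap.id ℝ (EuclideanSpace ℝ (Fin n))).prod 0) x :=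
      (hasFDerivAt_id x).prodMk (hasFDerivAt_const t x)
    have h := HasFDerivAt.comp (g := P) (f := fun y => (y, t)) x (hPd x t ht) h1
    have h2 : P ∘ (fun y => (y, t)) = fun y => ρ y t := rfl
    rw [h2] at h
    rw [h.fderiv]; simp
  have hft : ∀ x, ∀ t ∈ Ioo (0:ℝ) t₀, pt ρ x t = fderiv ℝ P (x, t) (0, 1) := by
    intro x t ht
    have h : HasDerivAt (fun s => ρ x s) _ t :=
      (hPd x t ht).comp_hasDerivAt t ((hasDerivAt_const t x).prodMk (hasDerivAt_id t))
    exact h.deriv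
  have hR0 : 0 < R := hR.1
  have hRt : R ^ 2 < t₀ := (Real.lt_sqrt hR0.le).1 hR.2
  set T := t₀ - R ^ 2 with hT
  have hTm : T ∈ Ioo (0:ℝ) t₀ := ⟨by linarith, by have := pow_pos hR0 2; linarith⟩
  have hτ : T / 2 ∈ Ioo (0:ℝ) t₀ := ⟨by linarith [hTm.1], by linarith [hTm.1, hTm.2]⟩
  obtain ⟨C, hC⟩ := hbdd (T/2) hτ
  have hTm' : T ∈ Ioo (T/2) t₀ := ⟨by linarith [hTm.1], hTm.2⟩
  have hC0 : 0 ≤ C := (norm_nonneg _).trans (hC 0 T hTm').2.1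
  let s : Set ℝ := {r | 0 < r ∧ T/2 < t₀ - r ^ 2}
  have hs : s ∈ 𝓝 R := by
    refine IsOpen.mem_nhds ?_ ⟨hR0, hTm'.1⟩
    have c : Continuous fun r : ℝ => t₀ - r ^ 2 := by fun_prop
    exact (isOpen_lt continuous_const continuous_id).inter (isOpen_lt continuous_const c)
  have hsm : ∀ r ∈ s, t₀ - r ^ 2 ∈ Ioo (T/2) t₀ := fun r hr =>
    ⟨hr.2, by have := pow_pos hr.1 2; linarith⟩
  have hsm0 : ∀ r ∈ s, t₀ - r ^ 2 ∈ Ioo 0 t₀ := fun r hr =>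
    ⟨hτ.1.trans (hsm r hr).1, (hsm r hr).2⟩
  have hst : ∀ r ∈ s, r ≤ t₀ + 1 := fun r hr => by
    have := hr.2; have := hτ.1; nlinarith [sq_nonneg (r - 1), hr.1]
  have ht0 : 0 < t₀ := hTm.1.trans hTm.2
  have caff : ∀ r : ℝ, Continuous fun y : EuclideanSpace ℝ (Fin n) => x₀ + r • y := fun r => by
    fun_prop
  have cg : Continuous fun y : EuclideanSpace ℝ (Fin n) => gw y := (gw_contDiff n).continuous
  have cF : ∀ r ∈ s, Continuous fun y => ρ (x₀ + r • y) (t₀ - r ^ 2) * gw y := fun r hr =>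
    ((hslice _ (hsm0 r hr)).continuous.comp (caff r)).mul cg
  have cfd : Continuous fun x => fderiv ℝ (fun y => ρ y T) x :=
    (hslice T hTm).continuous_fderiv (by simp)
  have cpt : Continuous fun x => pt ρ x T := by
    have h1 : ContinuousOn (fderiv ℝ P) (univ ×ˢ Ioo (0 : ℝ) t₀) :=
      hρsmooth.continuousOn_fderiv_of_isOpen hopen (by simp)
    have h2 : Continuous fun x => fderiv ℝ P (x, T) :=
      h1.comp_continuous (by fun_prop) (fun x => ⟨mem_univ _, hTm⟩)
    have h3 := h2.clm_apply (continuous_const (y := ((0 : EuclideanSpace ℝ (Fin n)), (1:ℝ))))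
    exact h3.congr fun x => (hft x T hTm).symm
  let F' : ℝ → EuclideanSpace ℝ (Fin n) → ℝ := fun r y =>
    (fderiv ℝ (fun z => ρ z (t₀ - r ^ 2)) (x₀ + r • y) y
      - 2 * r * pt ρ (x₀ + r • y) (t₀ - r ^ 2)) * gw y
  have main := hasDerivAt_integral_of_dominated_loc_of_deriv_le (μ := volume) (𝕜 := ℝ) hs
    (F := fun r y => ρ (x₀ + r • y) (t₀ - r ^ 2) * gw y) (F' := F')
    (bound := fun y => C * (‖y‖ * gw y) + 2 * (t₀ + 1) * C * gw y)
    (eventually_of_mem hs fun r hr => (cF r hr).aestronglyMeasurable)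
    (by
      refine Integrable.mono' ((gw_int n).const_mul C)
        (cF R (mem_of_mem_nhds hs)).aestronglyMeasurable (Eventually.of_forall fun y => ?_)
      have h1 := hρnonneg (x₀ + R • y) T hTm
      have h2 := gw_pos y
      rw [Real.norm_of_nonneg (mul_nonneg h1 h2.le)]
      exact mul_le_mul_of_nonneg_right (hC _ T hTm').1 h2.le)
    (by
      refine Continuous.aestronglyMeasurable ?_
      exact (((cfd.comp (caff R)).clm_apply continuous_id).sub
        (continuous_const.mul (cpt.comp (caff R)))).mul cg)
    (by
      refine Eventually.of_forall fun y r hr => ?_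
      have h2 := gw_pos y
      obtain ⟨-, b1, -, b2⟩ := hC (x₀ + r • y) _ (hsm r hr)
      have b3 := ((fderiv ℝ (fun z => ρ z (t₀ - r ^ 2)) (x₀ + r • y)).le_opNorm y).trans
        (mul_le_mul_of_nonneg_right b1 (norm_nonneg y))
      have b4 : |2 * r * pt ρ (x₀ + r • y) (t₀ - r ^ 2)| ≤ 2 * (t₀ + 1) * C := by
        rw [abs_mul, abs_of_nonneg (by linarith [hr.1] : (0:ℝ) ≤ 2 * r)]
        exact mul_le_mul (by linarith [hst r hr]) b2 (abs_nonneg _) (by linarith)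
      simp only [F']
      rw [norm_mul, Real.norm_of_nonneg h2.le]
      have b5 := (norm_sub_le (fderiv ℝ (fun z => ρ z (t₀ - r ^ 2)) (x₀ + r • y) y)
        (2 * r * pt ρ (x₀ + r • y) (t₀ - r ^ 2))).trans (add_le_add b3 b4)
      refine (mul_le_mul_of_nonneg_right b5 h2.le).trans (le_of_eq (by ring)))
    (((gw_norm_int n).const_mul C).add ((gw_int n).const_mul _))
    (by
      refine Eventually.of_forall fun y r hr => ?_
      refine HasDerivAt.mul_const ?_ _
      have d1 : HasDerivAt (fun r : ℝ => x₀ + r • y) y r := by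
        simpa using ((hasDerivAt_id r).smul_const y).const_add x₀
      have d2 : HasDerivAt (fun r : ℝ => t₀ - r ^ 2) (-(2 * r)) r := by
        simpa using (hasDerivAt_pow 2 r).const_sub t₀
      have d3 := HasFDerivAt.comp_hasDerivAt (l := P) (f := fun r => (x₀ + r • y, t₀ - r ^ 2)) r
        (hPd (x₀ + r • y) _ (hsm0 r hr)) (d1.prodMk d2)
      have h2 : P ∘ (fun r => (x₀ + r • y, t₀ - r ^ 2))
        = fun r => ρ (x₀ + r • y) (t₀ - r ^ 2) := rfl
      rw [h2] at d3
      refine d3.congr_deriv ?_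
      symm
      rw [hfx _ _ (hsm0 r hr), hft _ _ (hsm0 r hr)]
      have : (y, -(2 * r)) = (y, (0:ℝ)) + (-(2*r)) • ((0 : EuclideanSpace ℝ (Fin n)), (1:ℝ)) := by
        ext <;> simp
      rw [this, map_add, map_smul, smul_eq_mul]
      ring)
  -- integrate by parts
  let u : Fin n → EuclideanSpace ℝ (Fin n) → ℝ := fun j y => px ρ j (x₀ + R • y) T
  have hpx : ∀ j, ContDiff ℝ 1 (fun x => px ρ j x T) := fun j =>
    ((hslice T hTm).fderiv_right (m := 1) (by norm_cast)).clm_apply contDiff_const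
  have hu : ∀ j, ContDiff ℝ 1 (u j) := fun j => (hpx j).comp (by fun_prop)
  have hud : ∀ j y v, fderiv ℝ (u j) y v = R * fderiv ℝ (fun x => px ρ j x T) (x₀ + R • y) v := by
    intro j y v
    have h1 : HasFDerivAt (fun y : EuclideanSpace ℝ (Fin n) => x₀ + R • y)
        (R • ContinuousLinearMap.id ℝ (EuclideanSpace ℝ (Fin n))) y :=
      ((hasFDerivAt_id y).const_smul R).const_add x₀
    have h := HasFDerivAt.comp (g := fun x => px ρ j x T) (f := fun y => x₀ + R • y) y
      (((hpx j).differentiable one_ne_zero (x₀ + R • y)).hasFDerivAt) h1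
    have h2 : (fun x => px ρ j x T) ∘ (fun y => x₀ + R • y) = u j := rfl
    rw [h2] at h
    rw [h.fderiv]; simp
  have hsum : ∀ y, ∑ j, fderiv ℝ (u j) y (EuclideanSpace.single j 1)
      = R * lapv ρ (x₀ + R • y) T := by
    intro y
    simp only [hud, ← Finset.mul_sum]
    rfl
  have hsum2 : ∀ y : EuclideanSpace ℝ (Fin n), ∑ j, y j * u j y
      = fderiv ℝ (fun z => ρ z T) (x₀ + R • y) y := fun y => sum_single _ y
  have ibp := ibp_gauss u hu (C * (1 + R))
    (fun j y => by
      have h1 := (fderiv ℝ (fun z => ρ z T) (x₀ + R • y)).le_opNorm (EuclideanSpace.single j 1)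
      have h2 := (hC (x₀ + R • y) T hTm').2.1
      rw [show ‖(EuclideanSpace.single j (1:ℝ) : EuclideanSpace ℝ (Fin n))‖ = 1 by simp, mul_one] at h1
      have : |u j y| ≤ C := h1.trans h2
      nlinarith)
    (fun y => by
      rw [hsum, abs_mul, abs_of_pos hR0]
      have := (hC (x₀ + R • y) T hTm').2.2.1
      nlinarith)
  simp only [hsum, hsum2] at ibp
  have cS : Continuous fun y => R * lapv ρ (x₀ + R • y) T := by
    simp only [← hsum]
    exact continuous_finsetSum _ fun j _ =>
      ((hu j).continuous_fderiv one_ne_zero).clm_apply continuous_const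
  have iL : Integrable fun y => (R * lapv ρ (x₀ + R • y) T) * gw y := by
    refine Integrable.mono' ((gw_int n).const_mul (R * C)) (cS.mul cg).aestronglyMeasurable
      (Eventually.of_forall fun y => ?_)
    have h2 := gw_pos y
    rw [norm_mul, norm_mul, Real.norm_of_nonneg h2.le, Real.norm_of_nonneg hR0.le]
    have := (hC (x₀ + R • y) T hTm').2.2.1
    gcongr
    exact this
  have ip : Integrable fun y => (2 * R * pt ρ (x₀ + R • y) T) * gw y := by
    refine Integrable.mono' ((gw_int n).const_mul (2 * R * C))
      ((continuous_const.mul (cpt.comp (caff R))).mul cg).aestronglyMeasurable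
      (Eventually.of_forall fun y => ?_)
    have h2 := gw_pos y
    rw [norm_mul, norm_mul, Real.norm_of_nonneg h2.le,
      Real.norm_of_nonneg (by positivity : (0:ℝ) ≤ 2 * R)]
    have := (hC (x₀ + R • y) T hTm').2.2.2
    gcongr
    exact this
  have iD : Integrable fun y => (fderiv ℝ (fun z => ρ z T) (x₀ + R • y) y) * gw y := by
    refine (main.1.add ip).congr (Eventually.of_forall fun y => ?_)
    simp only [F', Pi.add_apply, ← hT]
    ring
  have e0 : (fun y => (2 * R * (lapv ρ (x₀ + R • y) T - pt ρ (x₀ + R • y) T)) * gw y)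
      = fun y => 2 * ((R * lapv ρ (x₀ + R • y) T) * gw y)
        - (2 * R * pt ρ (x₀ + R • y) T) * gw y := by
    ext y; ring
  refine ⟨by rw [e0]; exact (iL.const_mul 2).sub ip, ?_⟩
  refine main.2.congr_deriv ?_
  symm
  have e1 : F' R = fun y => (fderiv ℝ (fun z => ρ z T) (x₀ + R • y) y) * gw y
        - (2 * R * pt ρ (x₀ + R • y) T) * gw y := by
    ext y; simp only [F', ← hT]; ring
  rw [e0, e1, integral_sub (iL.const_mul 2) ip, integral_sub iD ip, integral_const_mul, ibp]
  ring

/-- If `∂ₜρ − Δρ ≤ −2e` with `ρ` smooth nonnegative and `e` continuous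
nonnegative (with suitable boundedness), then
`H(R) = ∫ ρ(·, t₀−R²) G_{z₀}(·, t₀−R²)` is differentiable and
`E(R) ≤ (R/2) H′(R)` for `0 < R < √t₀`; in particular `H` is nondecreasing. -/
theorem stmt_14 (n : ℕ) (hn : 1 ≤ n) (x₀ : EuclideanSpace ℝ (Fin n)) (t₀ : ℝ)
    (ht₀ : 0 < t₀)
    (ρ e : EuclideanSpace ℝ (Fin n) → ℝ → ℝ)
    (hρsmooth : ContDiffOn ℝ (⊤ : ℕ∞)
      (fun p : EuclideanSpace ℝ (Fin n) × ℝ => ρ p.1 p.2) (univ ×ˢ Ioo (0 : ℝ) t₀))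
    (hρnonneg : ∀ x : EuclideanSpace ℝ (Fin n), ∀ t ∈ Ioo (0 : ℝ) t₀, 0 ≤ ρ x t)
    (hecont : ContinuousOn
      (fun p : EuclideanSpace ℝ (Fin n) × ℝ => e p.1 p.2) (univ ×ˢ Ioo (0 : ℝ) t₀))
    (henonneg : ∀ x : EuclideanSpace ℝ (Fin n), ∀ t ∈ Ioo (0 : ℝ) t₀, 0 ≤ e x t)
    (hineq : ∀ x : EuclideanSpace ℝ (Fin n), ∀ t ∈ Ioo (0 : ℝ) t₀,
      pt ρ x t - lapv ρ x t ≤ -2 * e x t)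
    (hbdd : ∀ τ ∈ Ioo (0 : ℝ) t₀, ∃ Cb : ℝ,
      ∀ x : EuclideanSpace ℝ (Fin n), ∀ t ∈ Ioo τ t₀,
        ρ x t ≤ Cb ∧ ‖fderiv ℝ (fun y => ρ y t) x‖ ≤ Cb ∧
          |lapv ρ x t| ≤ Cb ∧ |pt ρ x t| ≤ Cb)
    (H E : ℝ → ℝ)
    (hH : ∀ R : ℝ, H R =
      ∫ x : EuclideanSpace ℝ (Fin n), ρ x (t₀ - R ^ 2) * bkHeatKernel x₀ t₀ x (t₀ - R ^ 2))
    (hE : ∀ R : ℝ, E R = 2 * R ^ 2 *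
      ∫ x : EuclideanSpace ℝ (Fin n), e x (t₀ - R ^ 2) * bkHeatKernel x₀ t₀ x (t₀ - R ^ 2)) :
    (∀ R ∈ Ioo (0 : ℝ) (Real.sqrt t₀),
      DifferentiableAt ℝ H R ∧ E R ≤ (R / 2) * deriv H R) ∧
    MonotoneOn H (Ioo (0 : ℝ) (Real.sqrt t₀)) := by
  set c : ℝ := (4 * Real.pi) ^ (-(n : ℝ) / 2) with hc
  have hc0 : 0 < c := by positivity
  have main : ∀ R ∈ Ioo (0 : ℝ) (Real.sqrt t₀),
      DifferentiableAt ℝ H R ∧ E R ≤ (R / 2) * deriv H R := by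
    intro R hR
    obtain ⟨hi, hd⟩ := main_deriv n x₀ t₀ ρ hρsmooth hρnonneg hbdd R hR
    have hR0 : 0 < R := hR.1
    have hRt : R ^ 2 < t₀ := (Real.lt_sqrt hR0.le).1 hR.2
    have hTm : t₀ - R ^ 2 ∈ Ioo (0:ℝ) t₀ :=
      ⟨by linarith, by have := pow_pos hR0 2; linarith⟩
    have hHd := (hd.const_mul c).congr_of_eventuallyEq (f₁ := H) (by
      filter_upwards [lt_mem_nhds hR0] with r hr
      rw [hH, scale_int x₀ t₀ r hr (fun x => ρ x (t₀ - r ^ 2))])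
    refine ⟨hHd.differentiableAt, ?_⟩
    rw [hHd.deriv, hE, scale_int x₀ t₀ R hR0 (fun x => e x (t₀ - R ^ 2))]
    have hle : ∫ y, 4 * R * (e (x₀ + R • y) (t₀ - R ^ 2) * gw y) ≤
        ∫ y, (2 * R * (lapv ρ (x₀ + R • y) (t₀ - R ^ 2)
        - pt ρ (x₀ + R • y) (t₀ - R ^ 2))) * gw y := by
      refine integral_mono_of_nonneg (Eventually.of_forall fun y => ?_) hi
        (Eventually.of_forall fun y => ?_)
      · have := henonneg (x₀ + R • y) _ hTm
        have := gw_pos y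
        simp only [Pi.zero_apply]
        positivity
      · have h1 := hineq (x₀ + R • y) _ hTm
        have h2 := gw_pos y
        simp only
        rw [← mul_assoc]
        refine mul_le_mul_of_nonneg_right ?_ h2.le
        nlinarith
    rw [integral_const_mul] at hle
    have := mul_le_mul_of_nonneg_left hle (by positivity : 0 ≤ R / 2 * c)
    linarith
  refine ⟨main, ?_⟩
  refine monotoneOn_of_deriv_nonneg (convex_Ioo _ _)
    (fun R hR => (main R hR).1.continuousAt.continuousWithinAt) ?_ ?_
  · rw [interior_Ioo]
    exact fun R hR => (main R hR).1.differentiableWithinAt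
  · rw [interior_Ioo]
    intro R hR
    have hR0 : 0 < R := hR.1
    have hRt : R ^ 2 < t₀ := (Real.lt_sqrt hR0.le).1 hR.2
    have hTm : t₀ - R ^ 2 ∈ Ioo (0:ℝ) t₀ :=
      ⟨by linarith, by have := pow_pos hR0 2; linarith⟩
    have hE0 : 0 ≤ E R := by
      rw [hE, scale_int x₀ t₀ R hR0 (fun x => e x (t₀ - R ^ 2))]
      refine mul_nonneg (by positivity) (mul_nonneg hc0.le (integral_nonneg fun y => ?_))
      exact mul_nonneg (henonneg _ _ hTm) (gw_pos y).le
    exact nonneg_of_mul_nonneg_right (hE0.trans (main R hR).2) (by positivity)
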